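/- arXiv:1609.00048 — 3 statements merged into one kernel-verified Lean document; each statement's English description precedes it below -/
import Mathlib

section
/- Fix a symmetric matrix A ∈ ℝ^{n×n} (A = Aᵀ) and sketch size parameters k, ℓ with k ≤ n, ℓ ≤ n, and ℓ > k + 1. Let Ω ∈ ℝ^{n×k} and Ψ ∈ ℝ^{ℓ×n} be independent real standard normal random matrices. Let Q = Q(Ω) ∈ ℝ^{n×k} be a measurable function of Ω such that Q has orthonormal columns (QᵀQ = I_k) and the column space of Q contains the column space of AΩ; define (almost surely) X := ((ΨQ)ᵀ(ΨQ))⁻¹(ΨQ)ᵀ Ψ A and the symmetric approximation Â_sym := (QX + (QX)ᵀ)/2. Then for every natural number ϱ with ϱ < k − 1, E ‖A − Â_sym‖_F² ≤ (1 + k/(ℓ − k − 1)) · (1 + ϱ/(k − ϱ − 1)) · τ_{ϱ+1}(A)². (Corollary 5.3, low-rank symmetric approximation error, real case.) -/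
open Matrix MeasureTheory ProbabilityTheory

/-- Squared Frobenius norm of a real matrix. -/
noncomputable def frobSq {m n : ℕ} (M : Matrix (Fin m) (Fin n) ℝ) : ℝ :=
  ∑ i, ∑ j, ‖M i j‖ ^ 2

/-- Squared `j`-th tail energy: `τ_j(A)² = inf {‖A - B‖_F² : rank B < j}`. -/
noncomputable def tailEnergySq {m n : ℕ} (A : Matrix (Fin m) (Fin n) ℝ) (j : ℕ) : ℝ :=
  sInf {x : ℝ | ∃ B : Matrix (Fin m) (Fin n) ℝ, B.rank < j ∧ x = frobSq (A - B)}

instance matrixMeasurableSpace {t s : ℕ} : MeasurableSpace (Matrix (Fin t) (Fin s) ℝ) :=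
  MeasurableSpace.pi

/-- The law of a `t × s` real standard normal matrix: the entries are independent
standard Gaussians. -/
noncomputable def gaussMatrix (t s : ℕ) : Measure (Matrix (Fin t) (Fin s) ℝ) :=
  Measure.pi fun _ : Fin t => Measure.pi fun _ : Fin s => gaussianReal 0 1

/-- The law of a standard normal vector in `ℝ^d`. -/
noncomputable def gaussVec (d : ℕ) : Measure (Fin d → ℝ) :=
  Measure.pi fun _ : Fin d => gaussianReal 0 1

instance gaussVec.instIsProbabilityMeasure (d : ℕ) : IsProbabilityMeasure (gaussVec d) := by
  unfold gaussVec; infer_instance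

instance gaussMatrix.instIsProbabilityMeasure (t s : ℕ) :
    IsProbabilityMeasure (gaussMatrix t s) :=
  inferInstanceAs (IsProbabilityMeasure (Measure.pi fun _ : Fin t => gaussVec s))

lemma integral_cexp_gaussVec {d : ℕ} (t : Fin d → ℝ) :
    ∫ x, Complex.exp ((∑ i, t i * x i : ℝ) * Complex.I) ∂gaussVec d
      = Complex.exp (-(∑ i, t i ^ 2 : ℝ) / 2) := by
  have h : ∀ x : Fin d → ℝ, Complex.exp ((∑ i, t i * x i : ℝ) * Complex.I)
      = ∏ i, Complex.exp (t i * x i * Complex.I) := by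
    intro x
    rw [← Complex.exp_sum, Complex.ofReal_sum, Finset.sum_mul]
    simp
  simp_rw [h, gaussVec]
  rw [integral_fintype_prod_eq_prod (f := fun i (y : ℝ) => Complex.exp (t i * y * Complex.I))]
  simp_rw [← charFun_apply_real, charFun_gaussianReal, ← Complex.exp_sum]
  congr 1
  push_cast
  rw [neg_div, Finset.sum_div, ← Finset.sum_neg_distrib]
  simp

lemma integral_cexp_gaussMatrix {r m : ℕ} (T : Matrix (Fin r) (Fin m) ℝ) :
    ∫ Ω, Complex.exp ((∑ i, ∑ j, T i j * Ω i j : ℝ) * Complex.I) ∂gaussMatrix r m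
      = Complex.exp (-(∑ i, ∑ j, T i j ^ 2 : ℝ) / 2) := by
  have h : ∀ Ω : Fin r → Fin m → ℝ,
      Complex.exp ((∑ i, ∑ j, T i j * Ω i j : ℝ) * Complex.I)
      = ∏ i, Complex.exp ((∑ j, T i j * Ω i j : ℝ) * Complex.I) := by
    intro x
    rw [← Complex.exp_sum, Complex.ofReal_sum, Finset.sum_mul]
  have h2 := integral_fintype_prod_eq_prod (ι := Fin r) (E := fun _ => Fin m → ℝ)
    (μ := fun _ => gaussVec m)
    (f := fun i (y : Fin m → ℝ) => Complex.exp ((∑ j, T i j * y j : ℝ) * Complex.I))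
  simp_rw [integral_cexp_gaussVec, ← h, ← Complex.exp_sum] at h2
  refine h2.trans ?_
  congr 1
  push_cast
  rw [neg_div, Finset.sum_div, ← Finset.sum_neg_distrib]
  simp [neg_div]

lemma apply_eq_sum_single {ι E : Type*} [Fintype ι] [DecidableEq ι] [NormedAddCommGroup E]
    [NormedSpace ℝ E] (L : StrongDual ℝ (ι → E)) (x : ι → E) :
    L x = ∑ i, L (Pi.single i (x i)) := by
  conv_lhs => rw [← Finset.univ_sum_single x]
  rw [map_sum]

lemma eq_gaussVec_of_integral_cexp {d : ℕ} (μ : Measure (Fin d → ℝ)) [IsFiniteMeasure μ]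
    (h : ∀ t : Fin d → ℝ, ∫ x, Complex.exp ((∑ i, t i * x i : ℝ) * Complex.I) ∂μ
      = Complex.exp (-(∑ i, t i ^ 2 : ℝ) / 2)) : μ = gaussVec d := by
  refine Measure.ext_of_charFunDual (funext fun L => ?_)
  obtain ⟨c, hc⟩ : ∃ c : Fin d → ℝ, ∀ x, L x = ∑ i, c i * x i := by
    refine ⟨fun i => L (Pi.single i 1), fun x => ?_⟩
    rw [apply_eq_sum_single L x]
    refine Finset.sum_congr rfl fun i _ => ?_
    rw [mul_comm, ← smul_eq_mul, ← map_smul, ← Pi.single_smul', smul_eq_mul, mul_one]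
  rw [charFunDual_apply, charFunDual_apply]
  simp_rw [hc]
  rw [h, integral_cexp_gaussVec]

lemma eq_pi_gaussVec_of_integral_cexp {r m : ℕ} (μ : Measure (Fin r → Fin m → ℝ))
    [IsFiniteMeasure μ]
    (h : ∀ T : Matrix (Fin r) (Fin m) ℝ,
      ∫ Ω, Complex.exp ((∑ i, ∑ j, T i j * Ω i j : ℝ) * Complex.I) ∂μ
      = Complex.exp (-(∑ i, ∑ j, T i j ^ 2 : ℝ) / 2)) :
    μ = Measure.pi fun _ => gaussVec m := by
  refine Measure.ext_of_charFunDual (E := Fin r → Fin m → ℝ) (funext fun L => ?_)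
  obtain ⟨c, hc⟩ : ∃ c : Matrix (Fin r) (Fin m) ℝ, ∀ x, L x = ∑ i, ∑ j, c i j * x i j := by
    refine ⟨fun i j => L (Pi.single i (Pi.single j 1)), fun x => ?_⟩
    rw [apply_eq_sum_single L x]
    refine Finset.sum_congr rfl fun i _ => ?_
    refine (apply_eq_sum_single
      (L.comp (ContinuousLinearMap.single ℝ (fun _ : Fin r => Fin m → ℝ) i)) (x i)).trans ?_
    refine Finset.sum_congr rfl fun j _ => ?_
    rw [ContinuousLinearMap.comp_apply, ContinuousLinearMap.single_apply, mul_comm,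
      ← smul_eq_mul, ← map_smul, ← Pi.single_smul', ← Pi.single_smul', smul_eq_mul, mul_one]
  rw [charFunDual_apply, charFunDual_apply]
  simp_rw [hc]
  exact (h c).trans (integral_cexp_gaussMatrix c).symm

lemma eq_gaussMatrix_of_integral_cexp {r m : ℕ} (μ : Measure (Matrix (Fin r) (Fin m) ℝ))
    [hμ : IsFiniteMeasure μ]
    (h : ∀ T : Matrix (Fin r) (Fin m) ℝ,
      ∫ Ω, Complex.exp ((∑ i, ∑ j, T i j * Ω i j : ℝ) * Complex.I) ∂μ
      = Complex.exp (-(∑ i, ∑ j, T i j ^ 2 : ℝ) / 2)) : μ = gaussMatrix r m :=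
  @eq_pi_gaussVec_of_integral_cexp r m μ hμ h

lemma measurable_matrix_transpose {r m : ℕ} :
    Measurable (fun Ω : Matrix (Fin r) (Fin m) ℝ => Ωᵀ) :=
  measurable_pi_lambda _ fun i => measurable_pi_lambda _ fun j =>
    (measurable_pi_apply i).comp (measurable_pi_apply j)

lemma measurable_matrix_entry {r m : ℕ} (i : Fin r) (j : Fin m) :
    Measurable (fun Ω : Matrix (Fin r) (Fin m) ℝ => Ω i j) :=
  (measurable_pi_apply j).comp (measurable_pi_apply i)

lemma measurable_matrix_mul_left {r n m : ℕ} (V : Matrix (Fin r) (Fin n) ℝ) :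
    Measurable (fun Ω : Matrix (Fin n) (Fin m) ℝ => V * Ω) :=
  measurable_pi_lambda _ fun i => measurable_pi_lambda _ fun j => by
    simp only [Matrix.mul_apply]
    exact Finset.measurable_sum _ fun k _ => (measurable_matrix_entry k j).const_mul _

lemma aestronglyMeasurable_cexp_matrix {r m : ℕ} (T : Matrix (Fin r) (Fin m) ℝ)
    (μ : Measure (Matrix (Fin r) (Fin m) ℝ)) :
    AEStronglyMeasurable
      (fun Ω => Complex.exp ((∑ i, ∑ j, T i j * Ω i j : ℝ) * Complex.I)) μ := by
  refine Measurable.aestronglyMeasurable ?_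
  refine Complex.measurable_exp.comp (Measurable.mul_const (Complex.measurable_ofReal.comp ?_) _)
  exact Finset.measurable_sum _ fun i _ => Finset.measurable_sum _ fun j _ =>
    (measurable_matrix_entry i j).const_mul _

lemma map_transpose_gaussMatrix (r m : ℕ) :
    (gaussMatrix r m).map (fun Ω => Ωᵀ) = gaussMatrix m r := by
  have := Measure.isProbabilityMeasure_map (μ := gaussMatrix r m)
    measurable_matrix_transpose.aemeasurable
  refine eq_gaussMatrix_of_integral_cexp _ fun T => ?_
  rw [integral_map measurable_matrix_transpose.aemeasurable
    (aestronglyMeasurable_cexp_matrix T _)]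
  simp only [Matrix.transpose_apply]
  rw [Finset.sum_comm (f := fun i j => T i j ^ 2), ← integral_cexp_gaussMatrix (fun i j => T j i)]
  simp_rw [Finset.sum_comm (s := (Finset.univ : Finset (Fin m)))]

lemma sum_mul_mul_eq {r n m : ℕ} (V : Matrix (Fin r) (Fin n) ℝ) (T : Matrix (Fin r) (Fin m) ℝ)
    (Ω : Matrix (Fin n) (Fin m) ℝ) :
    ∑ i, ∑ j, T i j * (V * Ω) i j = ∑ i, ∑ j, (Vᵀ * T) i j * Ω i j := by
  have h : ∀ (p : ℕ) (X Y : Matrix (Fin p) (Fin m) ℝ),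
      ∑ i, ∑ j, X i j * Y i j = (X * Yᵀ).trace := by
    intro p X Y
    simp [Matrix.trace, Matrix.mul_apply]
  rw [h, h, Matrix.transpose_mul, ← Matrix.mul_assoc, Matrix.trace_mul_comm, Matrix.mul_assoc]

lemma map_mul_gaussMatrix {r n m : ℕ} (V : Matrix (Fin r) (Fin n) ℝ) (hV : V * Vᵀ = 1) :
    (gaussMatrix n m).map (fun Ω => V * Ω) = gaussMatrix r m := by
  have hm := measurable_matrix_mul_left (m := m) V
  have := Measure.isProbabilityMeasure_map (μ := gaussMatrix n m) hm.aemeasurable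
  refine eq_gaussMatrix_of_integral_cexp _ fun T => ?_
  rw [integral_map hm.aemeasurable (aestronglyMeasurable_cexp_matrix T _)]
  simp_rw [sum_mul_mul_eq]
  rw [integral_cexp_gaussMatrix]
  simp_rw [sq, ← sum_mul_mul_eq, ← Matrix.mul_assoc, hV, Matrix.one_mul]

lemma measurable_mulVec {d m : ℕ} (N : Matrix (Fin d) (Fin m) ℝ) :
    Measurable fun x : Fin m → ℝ => N *ᵥ x := by
  refine measurable_pi_lambda _ fun i => ?_
  simp only [Matrix.mulVec, dotProduct]
  fun_prop

lemma map_mulVec_gaussVec {d m : ℕ} (N : Matrix (Fin d) (Fin m) ℝ) (hN : N * Nᵀ = 1) :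
    (gaussVec m).map (fun x => N *ᵥ x) = gaussVec d := by
  have hm := measurable_mulVec N
  have := Measure.isProbabilityMeasure_map (μ := gaussVec m) hm.aemeasurable
  refine eq_gaussVec_of_integral_cexp _ fun t => ?_
  have hc : Measurable fun x : Fin d → ℝ =>
      Complex.exp ((∑ i, t i * x i : ℝ) * Complex.I) :=
    Complex.measurable_exp.comp
      (Measurable.mul_const (Complex.measurable_ofReal.comp (by fun_prop)) _)
  rw [integral_map hm.aemeasurable hc.aestronglyMeasurable]
  have h : ∀ x : Fin m → ℝ, ∑ i, t i * (N *ᵥ x) i = ∑ i, (t ᵥ* N) i * x i := fun x =>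
    Matrix.dotProduct_mulVec t N x
  simp_rw [h]
  rw [integral_cexp_gaussVec]
  have h2 : ∑ i, (t ᵥ* N) i ^ 2 = ∑ i, t i ^ 2 := by
    simp_rw [sq]
    rw [← h, ← Matrix.mulVec_transpose, Matrix.mulVec_mulVec, hN, Matrix.one_mulVec]
  rw [h2]

lemma integral_exp_neg_mul_sq_gaussianReal {t : ℝ} (ht : 0 < t) :
    ∫ x, Real.exp (-t * x ^ 2) ∂gaussianReal 0 1 = (1 + 2 * t) ^ (-(1 / 2) : ℝ) := by
  rw [integral_gaussianReal_eq_integral_smul one_ne_zero]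
  have h : ∀ x : ℝ, gaussianPDFReal 0 1 x • Real.exp (-t * x ^ 2)
      = (√(2 * Real.pi))⁻¹ * Real.exp (-(1 / 2 + t) * x ^ 2) := by
    intro x
    rw [gaussianPDFReal, smul_eq_mul, mul_assoc, ← Real.exp_add]
    congr 2
    · simp
    · simp; ring
  simp_rw [h]
  rw [integral_const_mul, integral_gaussian, ← Real.sqrt_inv, ← Real.sqrt_mul (by positivity),
    Real.rpow_neg (by positivity), ← Real.sqrt_eq_rpow, ← Real.sqrt_inv]
  congr 1
  have := Real.pi_pos
  field_simp

lemma integral_exp_neg_mul_sum_sq_gaussVec {d : ℕ} {t : ℝ} (ht : 0 < t) :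
    ∫ x, Real.exp (-t * ∑ i, x i ^ 2) ∂gaussVec d = (1 + 2 * t) ^ (-(d / 2) : ℝ) := by
  simp_rw [Finset.mul_sum, Real.exp_sum, gaussVec]
  rw [integral_fintype_prod_eq_prod (f := fun _ (y : ℝ) => Real.exp (-t * y ^ 2))]
  rw [integral_exp_neg_mul_sq_gaussianReal ht]
  simp only [Finset.prod_const, Finset.card_univ, Fintype.card_fin]
  rw [← Real.rpow_natCast, ← Real.rpow_mul (by positivity)]
  congr 1; ring

lemma lintegral_exp_neg_mul_sum_sq_gaussVec {d : ℕ} {t : ℝ} (ht : 0 < t) :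
    ∫⁻ x, ENNReal.ofReal (Real.exp (-t * ∑ i, x i ^ 2)) ∂gaussVec d
      = ENNReal.ofReal ((1 + 2 * t) ^ (-(d / 2) : ℝ)) := by
  rw [← integral_exp_neg_mul_sum_sq_gaussVec ht, ofReal_integral_eq_lintegral_ofReal]
  · refine Integrable.of_bound (C := 1) (Continuous.aestronglyMeasurable (by fun_prop))
      (.of_forall fun x => ?_)
    rw [Real.norm_eq_abs, abs_of_pos (Real.exp_pos _), Real.exp_le_one_iff]
    have : 0 ≤ ∑ i, x i ^ 2 := Finset.sum_nonneg fun i _ => sq_nonneg _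
    nlinarith
  · exact .of_forall fun x => (Real.exp_pos _).le

lemma inv_ofReal_le_lintegral_exp {s : ℝ} (hs : 0 ≤ s) :
    (ENNReal.ofReal s)⁻¹ ≤ ∫⁻ t in Set.Ioi (0 : ℝ), ENNReal.ofReal (Real.exp (-t * s)) := by
  rcases hs.eq_or_lt with rfl | hs
  · simp
  · have h := integral_exp_mul_Ioi (a := -s) (by linarith) 0
    have hi := integrableOn_exp_mul_Ioi (a := -s) (by linarith) 0
    have e : ∀ t : ℝ, Real.exp (-t * s) = Real.exp (-s * t) := fun t => by congr 1; ring
    simp_rw [e]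
    rw [← ofReal_integral_eq_lintegral_ofReal hi (.of_forall fun x => (Real.exp_pos _).le), h,
      ← ENNReal.ofReal_inv_of_pos hs]
    apply le_of_eq
    congr 1
    simp [neg_div_neg_eq]

lemma lintegral_Ioi_one_add_two_mul_rpow {d : ℝ} (hd : 2 < d) :
    ∫⁻ t in Set.Ioi (0 : ℝ), ENNReal.ofReal ((1 + 2 * t) ^ (-(d / 2) : ℝ))
      = ENNReal.ofReal (1 / (d - 2)) := by
  have hderiv : ∀ x ∈ Set.Ici (0 : ℝ), HasDerivAt
      (fun t : ℝ => -(1 / (d - 2)) * (1 + 2 * t) ^ (1 - d / 2)) ((1 + 2 * x) ^ (-(d / 2))) x := by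
    intro x hx
    have hx : (0 : ℝ) ≤ x := hx
    have h1 : HasDerivAt (fun t : ℝ => 1 + 2 * t) 2 x := by
      simpa using ((hasDerivAt_id x).const_mul 2).const_add 1
    have h2 := (h1.rpow_const (p := 1 - d / 2) (Or.inl (by positivity))).const_mul (-(1 / (d - 2)))
    convert! h2 using 1
    have : d - 2 ≠ 0 := by linarith
    rw [show 1 - d / 2 - 1 = -(d / 2) by ring]
    field_simp
    ring
  have hpos : ∀ x ∈ Set.Ioi (0 : ℝ), (0 : ℝ) ≤ (1 + 2 * x) ^ (-(d / 2)) := by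
    intro x hx
    have hx : (0 : ℝ) < x := hx
    positivity
  have hlim : Filter.Tendsto (fun t : ℝ => -(1 / (d - 2)) * (1 + 2 * t) ^ (1 - d / 2))
      Filter.atTop (nhds 0) := by
    have h1 : Filter.Tendsto (fun t : ℝ => 1 + 2 * t) Filter.atTop Filter.atTop :=
      Filter.tendsto_atTop_add_const_left _ _ (Filter.tendsto_id.const_mul_atTop (by norm_num))
    have h2 := (tendsto_rpow_neg_atTop (y := d / 2 - 1) (by linarith)).comp h1
    have h3 := h2.const_mul (-(1 / (d - 2)))
    simpa [Function.comp_def] using h3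
  have hint := integrableOn_Ioi_deriv_of_nonneg' hderiv hpos hlim
  have h := integral_Ioi_of_hasDerivAt_of_nonneg' hderiv hpos hlim
  rw [← ofReal_integral_eq_lintegral_ofReal hint
    ((ae_restrict_iff' measurableSet_Ioi).2 (.of_forall hpos)), h]
  simp

/-- The expectation of an inverse chi-squared variable with `d > 2` degrees of freedom. -/
lemma lintegral_inv_sum_sq_gaussVec_le {d : ℕ} (hd : 2 < d) :
    ∫⁻ x, (ENNReal.ofReal (∑ i, x i ^ 2))⁻¹ ∂gaussVec d ≤ ENNReal.ofReal (1 / ((d : ℝ) - 2)) := by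
  calc _ ≤ ∫⁻ x, (∫⁻ t in Set.Ioi (0 : ℝ),
        ENNReal.ofReal (Real.exp (-t * ∑ i, x i ^ 2))) ∂gaussVec d :=
        lintegral_mono fun x =>
          inv_ofReal_le_lintegral_exp (Finset.sum_nonneg fun i _ => sq_nonneg _)
    _ = ∫⁻ t in Set.Ioi (0 : ℝ), ∫⁻ x,
        ENNReal.ofReal (Real.exp (-t * ∑ i, x i ^ 2)) ∂gaussVec d :=
        lintegral_lintegral_swap (Measurable.aemeasurable (by fun_prop))
    _ = ∫⁻ t in Set.Ioi (0 : ℝ), ENNReal.ofReal ((1 + 2 * t) ^ (-((d : ℝ) / 2) : ℝ)) :=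
        setLIntegral_congr_fun measurableSet_Ioi fun t ht =>
          lintegral_exp_neg_mul_sum_sq_gaussVec ht
    _ = _ := lintegral_Ioi_one_add_two_mul_rpow (by exact_mod_cast hd)

lemma lintegral_sq_gaussianReal : ∫⁻ x, ENNReal.ofReal (x ^ 2) ∂gaussianReal 0 1 = 1 := by
  have h2 : MemLp id 2 (gaussianReal 0 1) := memLp_id_gaussianReal 2
  have hi : Integrable (fun x : ℝ => x ^ 2) (gaussianReal 0 1) := h2.integrable_sq
  rw [← ofReal_integral_eq_lintegral_ofReal hi (.of_forall fun x => sq_nonneg x)]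
  have h := variance_eq_sub h2
  rw [variance_id_gaussianReal] at h
  simp [integral_id_gaussianReal] at h
  simp [← h]

lemma lintegral_sq_dotProduct_gaussVec {m : ℕ} (a : Fin m → ℝ) :
    ∫⁻ g, ENNReal.ofReal ((a ⬝ᵥ g) ^ 2) ∂gaussVec m = ENNReal.ofReal (∑ i, a i ^ 2) := by
  set s := ∑ i, a i ^ 2 with hs
  have hs0 : 0 ≤ s := Finset.sum_nonneg fun i _ => sq_nonneg _
  rcases hs0.eq_or_lt with h0 | h0
  · have ha : a = 0 := by
      ext i
      have := (Finset.sum_eq_zero_iff_of_nonneg (fun i _ => sq_nonneg (a i))).1 h0.symm i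
        (Finset.mem_univ i)
      simpa using this
    simp [← h0, ha]
  · let N : Matrix (Fin 1) (Fin m) ℝ := Matrix.of fun _ j => a j / √s
    have hN : N * Nᵀ = 1 := by
      ext i j
      fin_cases i; fin_cases j
      simp only [N, Matrix.mul_apply, Matrix.transpose_apply, Matrix.of_apply]
      simp_rw [← sq, div_pow, Real.sq_sqrt hs0]
      rw [← Finset.sum_div, ← hs]
      simp [h0.ne']
    have hm := measurable_mulVec N
    have e : ∀ g : Fin m → ℝ, ENNReal.ofReal ((a ⬝ᵥ g) ^ 2)
        = ENNReal.ofReal s * ENNReal.ofReal ((N *ᵥ g) 0 ^ 2) := by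
      intro g
      rw [← ENNReal.ofReal_mul hs0]
      congr 1
      have : (N *ᵥ g) 0 = (a ⬝ᵥ g) / √s := by
        simp only [N, Matrix.mulVec, dotProduct, Matrix.of_apply]
        rw [Finset.sum_div]
        exact Finset.sum_congr rfl fun i _ => by ring
      rw [this, div_pow, Real.sq_sqrt hs0]
      field_simp
    simp_rw [e]
    rw [lintegral_const_mul' _ _ ENNReal.ofReal_ne_top,
      ← lintegral_map (f := fun x : Fin 1 → ℝ => ENNReal.ofReal (x 0 ^ 2)) (by fun_prop) hm,
      map_mulVec_gaussVec N hN, gaussVec,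
      (measurePreserving_eval (fun _ : Fin 1 => gaussianReal 0 1) 0).lintegral_comp
        (f := fun x : ℝ => ENNReal.ofReal (x ^ 2)) (by fun_prop),
      lintegral_sq_gaussianReal, mul_one]

lemma lintegral_sum_sq_mulVec_gaussVec {r m : ℕ} (S : Matrix (Fin r) (Fin m) ℝ) :
    ∫⁻ g, ENNReal.ofReal (∑ i, (S *ᵥ g) i ^ 2) ∂gaussVec m
      = ENNReal.ofReal (∑ i, ∑ j, S i j ^ 2) := by
  have h : ∀ g : Fin m → ℝ, ENNReal.ofReal (∑ i, (S *ᵥ g) i ^ 2)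
      = ∑ i, ENNReal.ofReal (((fun j => S i j) ⬝ᵥ g) ^ 2) := fun g =>
    ENNReal.ofReal_sum_of_nonneg fun i _ => sq_nonneg _
  simp_rw [h]
  rw [lintegral_finsetSum _ (fun i _ => by simp only [dotProduct]; fun_prop)]
  refine (Finset.sum_congr rfl fun i _ => lintegral_sq_dotProduct_gaussVec _).trans ?_
  exact (ENNReal.ofReal_sum_of_nonneg
    fun i _ => Finset.sum_nonneg fun j _ => sq_nonneg (S i j)).symm

lemma exists_orthonormal_rows {m d : ℕ} (S : Submodule ℝ (EuclideanSpace ℝ (Fin m)))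
    (hd : d ≤ Module.finrank ℝ S) :
    ∃ N : Matrix (Fin d) (Fin m) ℝ, N * Nᵀ = 1 ∧ ∀ i, WithLp.toLp 2 (N.row i) ∈ S := by
  let b := stdOrthonormalBasis ℝ S
  refine ⟨Matrix.of fun i j => (b (Fin.castLE hd i)).1 j, ?_, fun i => ?_⟩
  · ext i j
    have h := b.inner_eq_ite (Fin.castLE hd j) (Fin.castLE hd i)
    simp only [Submodule.coe_inner, PiLp.inner_apply, RCLike.inner_apply, conj_trivial] at h
    simp only [Matrix.mul_apply, Matrix.of_apply, Matrix.transpose_apply, h, Matrix.one_apply]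
    simp [Fin.ext_iff, eq_comm]
  · exact (b (Fin.castLE hd i)).2

lemma exists_orthonormal_rows_mul_transpose_eq_zero {r m d : ℕ} (H : Matrix (Fin r) (Fin m) ℝ)
    (hd : d + r ≤ m) :
    ∃ N : Matrix (Fin d) (Fin m) ℝ, N * Nᵀ = 1 ∧ N * Hᵀ = 0 := by
  have hk := (Matrix.toEuclideanLin H).finrank_range_add_finrank_ker
  have hr := (Matrix.toEuclideanLin H).range.finrank_le
  rw [finrank_euclideanSpace_fin] at hk hr
  obtain ⟨N, hN, hNS⟩ := exists_orthonormal_rows (d := d) (Matrix.toEuclideanLin H).ker (by omega)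
  refine ⟨N, hN, ?_⟩
  ext i j
  have h := hNS i
  rw [LinearMap.mem_ker] at h
  have h2 := congrArg (fun v => v j) h
  simp only [Matrix.toLpLin_apply, PiLp.zero_apply, Matrix.mulVec, dotProduct] at h2
  simp only [Matrix.mul_apply, Matrix.transpose_apply, Matrix.zero_apply]
  rw [← h2]
  exact Finset.sum_congr rfl fun k _ => mul_comm _ _

lemma exists_orthonormal_rows_rank {n p : ℕ} (B : Matrix (Fin p) (Fin n) ℝ) :
    ∃ V : Matrix (Fin B.rank) (Fin n) ℝ, V * Vᵀ = 1 ∧ B * Vᵀ * V = B := by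
  have hfr : Module.finrank ℝ (Matrix.toEuclideanLin Bᵀ).range = B.rank := by
    rw [← Matrix.rank_transpose, Matrix.rank_eq_finrank_range_toLin Bᵀ
      (EuclideanSpace.basisFun _ ℝ).toBasis (EuclideanSpace.basisFun _ ℝ).toBasis]
    rfl
  let b := (stdOrthonormalBasis ℝ (Matrix.toEuclideanLin Bᵀ).range).reindex (finCongr hfr)
  refine ⟨Matrix.of fun i j => (b i).1 j, ?_, ?_⟩
  · ext i j
    have h := b.inner_eq_ite j i
    simp only [Submodule.coe_inner, PiLp.inner_apply, RCLike.inner_apply, conj_trivial] at h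
    simp only [Matrix.mul_apply, Matrix.of_apply, Matrix.transpose_apply, h, Matrix.one_apply]
    simp [eq_comm]
  · ext i j
    have hi : WithLp.toLp 2 (B.row i) ∈ (Matrix.toEuclideanLin Bᵀ).range := by
      refine ⟨WithLp.toLp 2 (Pi.single i 1), ?_⟩
      ext k
      simp [Matrix.toLpLin_apply]
    have h := congrArg (fun v => v.1 j) (b.sum_repr' ⟨_, hi⟩)
    simp only [Submodule.coe_inner, PiLp.inner_apply, RCLike.inner_apply, conj_trivial,
      Submodule.coe_sum, Submodule.coe_smul, WithLp.ofLp_sum, Finset.sum_apply, WithLp.ofLp_smul,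
      Pi.smul_apply, smul_eq_mul] at h
    simp only [Matrix.mul_apply, Matrix.of_apply, Matrix.transpose_apply]
    exact h

lemma sum_sq_eq_dotProduct {m : ℕ} (x : Fin m → ℝ) : ∑ i, x i ^ 2 = x ⬝ᵥ x := by
  simp [dotProduct, sq]

lemma sum_sq_mulVec_le {d m : ℕ} (N : Matrix (Fin d) (Fin m) ℝ) (hN : N * Nᵀ = 1)
    (y : Fin m → ℝ) : ∑ i, (N *ᵥ y) i ^ 2 ≤ ∑ i, y i ^ 2 := by
  have h : 0 ≤ ∑ i, (y - Nᵀ *ᵥ (N *ᵥ y)) i ^ 2 := Finset.sum_nonneg fun i _ => sq_nonneg _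
  simp_rw [sum_sq_eq_dotProduct] at h ⊢
  have h1 : y ⬝ᵥ (Nᵀ *ᵥ (N *ᵥ y)) = (N *ᵥ y) ⬝ᵥ (N *ᵥ y) := by
    rw [Matrix.dotProduct_mulVec, Matrix.vecMul_transpose]
  have h2 : (Nᵀ *ᵥ (N *ᵥ y)) ⬝ᵥ (Nᵀ *ᵥ (N *ᵥ y)) = (N *ᵥ y) ⬝ᵥ (N *ᵥ y) := by
    rw [Matrix.dotProduct_mulVec, Matrix.vecMul_transpose, Matrix.mulVec_mulVec, hN,
      Matrix.one_mulVec]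
  rw [sub_dotProduct, dotProduct_sub, dotProduct_sub, h2, dotProduct_comm (Nᵀ *ᵥ _) y, h1] at h
  linarith

lemma mulVec_transpose_mulVec_eq_smul {r m d : ℕ} (T : Matrix (Fin r) (Fin m) ℝ)
    (N : Matrix (Fin d) (Fin m) ℝ) (j : Fin r) (hNT : ∀ k ≠ j, N *ᵥ T.row k = 0)
    (x : Fin r → ℝ) : N *ᵥ (Tᵀ *ᵥ x) = x j • (N *ᵥ T.row j) := by
  have h : Tᵀ *ᵥ x = ∑ k, x k • T.row k := by
    ext i
    simp [Matrix.mulVec, dotProduct, mul_comm]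
  rw [h, Matrix.mulVec_sum, Finset.sum_eq_single j]
  · rw [Matrix.mulVec_smul]
  · intro k _ hk
    rw [Matrix.mulVec_smul, hNT k hk, smul_zero]
  · simp

lemma ofReal_inv_gram_diag_le {r m d : ℕ} (T : Matrix (Fin r) (Fin m) ℝ)
    (N : Matrix (Fin d) (Fin m) ℝ) (hN : N * Nᵀ = 1) (j : Fin r)
    (hNT : ∀ k ≠ j, N *ᵥ T.row k = 0) :
    ENNReal.ofReal ((T * Tᵀ)⁻¹ j j) ≤ (ENNReal.ofReal (∑ i, (N *ᵥ T.row j) i ^ 2))⁻¹ := by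
  by_cases hdet : IsUnit (T * Tᵀ).det
  swap
  · simp [Matrix.nonsing_inv_apply_not_isUnit _ hdet]
  set c := (T * Tᵀ)⁻¹ j j with hc
  set s := ∑ i, (N *ᵥ T.row j) i ^ 2 with hs
  rcases le_or_gt c 0 with h0 | h0
  · simp [ENNReal.ofReal_of_nonpos h0]
  have hs0 : 0 ≤ s := Finset.sum_nonneg fun i _ => sq_nonneg _
  rcases hs0.eq_or_lt with h1 | h1
  · simp [← h1]
  set x := (T * Tᵀ)⁻¹ *ᵥ Pi.single j 1 with hx
  have hxj : x j = c := by simp [hx, hc]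
  have hy : ∑ i, (Tᵀ *ᵥ x) i ^ 2 = c := by
    rw [sum_sq_eq_dotProduct, Matrix.dotProduct_mulVec, Matrix.vecMul_transpose,
      Matrix.mulVec_mulVec, hx, Matrix.mulVec_mulVec, Matrix.mul_nonsing_inv _ hdet,
      Matrix.one_mulVec, ← hx]
    simp [hxj]
  have h2 := sum_sq_mulVec_le N hN (Tᵀ *ᵥ x)
  rw [hy, mulVec_transpose_mulVec_eq_smul T N j hNT, hxj] at h2
  simp only [Pi.smul_apply, smul_eq_mul, mul_pow] at h2
  rw [← Finset.mul_sum, ← hs] at h2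
  rw [← ENNReal.ofReal_inv_of_pos h1]
  refine ENNReal.ofReal_le_ofReal ?_
  rw [← one_div, le_div_iff₀ h1]
  nlinarith

lemma det_gram_ne_zero_iff {r m : ℕ} (T : Matrix (Fin r) (Fin m) ℝ) :
    (T * Tᵀ).det ≠ 0 ↔ ∀ x, Tᵀ *ᵥ x = 0 → x = 0 := by
  rw [← not_iff_not, not_not, ← Matrix.exists_mulVec_eq_zero_iff]
  push Not
  refine exists_congr fun x => ?_
  rw [and_comm, ← Matrix.conjTranspose_eq_transpose_of_trivial,
    Matrix.self_mul_conjTranspose_mulVec_eq_zero]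

lemma inv_gram_mul_mul_transpose {r m : ℕ} (T : Matrix (Fin r) (Fin m) ℝ) :
    ((T * Tᵀ)⁻¹ * T) * ((T * Tᵀ)⁻¹ * T)ᵀ = (T * Tᵀ)⁻¹ := by
  have hsymm : ((T * Tᵀ)⁻¹)ᵀ = (T * Tᵀ)⁻¹ := by
    rw [Matrix.transpose_nonsing_inv, Matrix.transpose_mul, Matrix.transpose_transpose]
  rw [Matrix.transpose_mul, hsymm, Matrix.mul_assoc, ← Matrix.mul_assoc T, ← Matrix.mul_assoc]
  by_cases hdet : IsUnit (T * Tᵀ).det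
  · rw [Matrix.nonsing_inv_mul _ hdet, Matrix.one_mul]
  · simp [Matrix.nonsing_inv_apply_not_isUnit _ hdet]

lemma sum_sq_inv_gram_mul {r m : ℕ} (T : Matrix (Fin r) (Fin m) ℝ) (i : Fin r) :
    ∑ j, ((T * Tᵀ)⁻¹ * T) i j ^ 2 = (T * Tᵀ)⁻¹ i i := by
  conv_rhs => rw [← inv_gram_mul_mul_transpose, Matrix.mul_apply]
  exact Finset.sum_congr rfl fun j _ => sq _

lemma measurable_det {α : Type*} [MeasurableSpace α] {r : ℕ} {M : α → Matrix (Fin r) (Fin r) ℝ}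
    (hM : ∀ i j, Measurable fun x => M x i j) : Measurable fun x => (M x).det := by
  simp only [Matrix.det_apply]
  refine Finset.measurable_sum _ fun σ _ => Measurable.const_smul ?_ _
  exact Finset.measurable_prod _ fun i _ => hM _ _

lemma measurable_inv_apply {α : Type*} [MeasurableSpace α] {r : ℕ}
    {M : α → Matrix (Fin r) (Fin r) ℝ} (hM : ∀ i j, Measurable fun x => M x i j) (i j : Fin r) :
    Measurable fun x => (M x)⁻¹ i j := by
  simp only [Matrix.inv_def, Ring.inverse_eq_inv', Matrix.smul_apply, smul_eq_mul,
    Matrix.adjugate_apply]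
  refine (measurable_det hM).inv.mul (measurable_det fun a b => ?_)
  simp only [Matrix.updateRow_apply]
  split_ifs
  · exact measurable_const
  · exact hM a b

lemma measurable_mul_apply {α : Type*} [MeasurableSpace α] {r m s : ℕ}
    {M : α → Matrix (Fin r) (Fin m) ℝ} {M' : α → Matrix (Fin m) (Fin s) ℝ}
    (hM : ∀ i j, Measurable fun x => M x i j) (hM' : ∀ i j, Measurable fun x => M' x i j)
    (i : Fin r) (j : Fin s) : Measurable fun x => (M x * M' x) i j := by
  simp only [Matrix.mul_apply]
  exact Finset.measurable_sum _ fun k _ => (hM i k).mul (hM' k j)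

lemma measurable_gram_apply {r m : ℕ} (i j : Fin r) :
    Measurable fun T : Matrix (Fin r) (Fin m) ℝ => (T * Tᵀ) i j :=
  measurable_mul_apply (measurable_matrix_entry)
    (fun a b => measurable_matrix_entry (r := r) (m := m) b a) i j

/-- The matrix obtained from `H` by inserting the row `g` at position `j`. -/
def insertRow {r m : ℕ} (j : Fin (r + 1)) (g : Fin m → ℝ) (H : Matrix (Fin r) (Fin m) ℝ) :
    Matrix (Fin (r + 1)) (Fin m) ℝ :=
  Matrix.of (Fin.insertNth (α := fun _ => Fin m → ℝ) j g H)

lemma insertRow_row_self {r m : ℕ} (j : Fin (r + 1)) (g : Fin m → ℝ)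
    (H : Matrix (Fin r) (Fin m) ℝ) : (insertRow j g H).row j = g :=
  Fin.insertNth_apply_same (α := fun _ => Fin m → ℝ) j g H

lemma insertRow_row_succAbove {r m : ℕ} (j : Fin (r + 1)) (g : Fin m → ℝ)
    (H : Matrix (Fin r) (Fin m) ℝ) (k : Fin r) :
    (insertRow j g H).row (j.succAbove k) = H.row k :=
  Fin.insertNth_apply_succAbove (α := fun _ => Fin m → ℝ) j g H k

lemma measurePreserving_insertRow {r m : ℕ} (j : Fin (r + 1)) :
    MeasurePreserving (fun p : (Fin m → ℝ) × Matrix (Fin r) (Fin m) ℝ => insertRow j p.1 p.2)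
      ((gaussVec m).prod (gaussMatrix r m)) (gaussMatrix (r + 1) m) :=
  (measurePreserving_piFinSuccAbove (fun _ : Fin (r + 1) => gaussVec m) j).symm

lemma lintegral_gaussMatrix_succ {r m : ℕ} (j : Fin (r + 1))
    {f : Matrix (Fin (r + 1)) (Fin m) ℝ → ENNReal} (hf : Measurable f) :
    ∫⁻ T, f T ∂gaussMatrix (r + 1) m
      = ∫⁻ H, ∫⁻ g, f (insertRow j g H) ∂gaussVec m ∂gaussMatrix r m := by
  have hp := measurePreserving_insertRow (r := r) (m := m) j
  rw [← hp.lintegral_comp hf]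
  exact lintegral_prod_symm' (fun p : (Fin m → ℝ) × Matrix (Fin r) (Fin m) ℝ =>
    f (insertRow j p.1 p.2)) (hf.comp hp.measurable)

lemma lintegral_inv_sum_sq_mulVec_le {d m : ℕ} (hd : 2 < d) (N : Matrix (Fin d) (Fin m) ℝ)
    (hN : N * Nᵀ = 1) :
    ∫⁻ g, (ENNReal.ofReal (∑ i, (N *ᵥ g) i ^ 2))⁻¹ ∂gaussVec m
      ≤ ENNReal.ofReal (1 / ((d : ℝ) - 2)) := by
  rw [← lintegral_map (f := fun x : Fin d → ℝ => (ENNReal.ofReal (∑ i, x i ^ 2))⁻¹)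
    (by fun_prop) (measurable_mulVec N), map_mulVec_gaussVec N hN]
  exact lintegral_inv_sum_sq_gaussVec_le hd

lemma ae_sum_sq_mulVec_ne_zero {d m : ℕ} (hd : 2 < d) (N : Matrix (Fin d) (Fin m) ℝ)
    (hN : N * Nᵀ = 1) : ∀ᵐ g ∂gaussVec m, N *ᵥ g ≠ 0 := by
  have hm : Measurable fun g : Fin m → ℝ => (ENNReal.ofReal (∑ i, (N *ᵥ g) i ^ 2))⁻¹ :=
    Measurable.comp (g := fun x : Fin d → ℝ => (ENNReal.ofReal (∑ i, x i ^ 2))⁻¹)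
      (by fun_prop) (measurable_mulVec N)
  have h := ae_lt_top hm ((lintegral_inv_sum_sq_mulVec_le hd N hN).trans_lt
    ENNReal.ofReal_lt_top).ne
  filter_upwards [h] with g hg h0
  simp [h0] at hg

lemma ae_det_gram_ne_zero {r m : ℕ} (hm : r + 1 < m) :
    ∀ᵐ T ∂gaussMatrix r m, (T * Tᵀ).det ≠ 0 := by
  induction r with
  | zero => simp
  | succ r ih =>
    have hmeas : MeasurableSet {T : Matrix (Fin (r + 1)) (Fin m) ℝ | (T * Tᵀ).det = 0} :=
      measurable_det measurable_gram_apply (measurableSet_singleton 0)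
    rw [ae_iff]
    simp only [ne_eq, not_not]
    rw [← lintegral_indicator_one hmeas,
      lintegral_gaussMatrix_succ 0 (measurable_one.indicator hmeas)]
    refine (lintegral_congr_ae ?_).trans lintegral_zero
    filter_upwards [ih (by omega)] with H hH
    obtain ⟨N, hN, hNH⟩ := exists_orthonormal_rows_mul_transpose_eq_zero (d := m - r) H (by omega)
    refine (lintegral_congr_ae ?_).trans lintegral_zero
    filter_upwards [ae_sum_sq_mulVec_ne_zero (by omega) N hN] with g hg
    rw [Set.indicator_of_notMem]
    change (insertRow 0 g H * (insertRow 0 g H)ᵀ).det ≠ 0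
    rw [det_gram_ne_zero_iff] at hH ⊢
    intro x hx
    have hx0 : x 0 = 0 := by
      have h := mulVec_transpose_mulVec_eq_smul (insertRow 0 g H) N 0 (fun k hk => ?_) x
      · rw [hx, Matrix.mulVec_zero, insertRow_row_self] at h
        exact (smul_eq_zero.1 h.symm).resolve_right hg
      · obtain ⟨k, rfl⟩ := Fin.exists_succAbove_eq hk
        rw [insertRow_row_succAbove]
        ext i
        exact congrFun (congrFun hNH i) k
    have hxt := hH (fun k => x k.succ) (by
      ext i
      have h := congrFun hx i
      simp only [Matrix.mulVec, dotProduct, Fin.sum_univ_succ, hx0, mul_zero, zero_add] at h ⊢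
      exact h)
    ext k
    refine Fin.cases hx0 (fun k => congrFun hxt k) k

lemma lintegral_inv_gram_diag_le {r m : ℕ} (hm : r + 1 < m) (j : Fin r) :
    ∫⁻ T, ENNReal.ofReal ((T * Tᵀ)⁻¹ j j) ∂gaussMatrix r m
      ≤ ENNReal.ofReal (1 / ((m : ℝ) - r - 1)) := by
  obtain ⟨r, rfl⟩ : ∃ r', r = r' + 1 := ⟨r - 1, by have := j.2; omega⟩
  have h : ∀ H : Matrix (Fin r) (Fin m) ℝ,
      ∫⁻ g, ENNReal.ofReal ((insertRow j g H * (insertRow j g H)ᵀ)⁻¹ j j) ∂gaussVec m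
        ≤ ENNReal.ofReal (1 / ((m : ℝ) - (r + 1 : ℕ) - 1)) := by
    intro H
    obtain ⟨N, hN, hNH⟩ := exists_orthonormal_rows_mul_transpose_eq_zero (d := m - r) H (by omega)
    have h2 := lintegral_inv_sum_sq_mulVec_le (by omega) N hN
    rw [Nat.cast_sub (by omega), show (m : ℝ) - r - 2 = m - (r + 1 : ℕ) - 1 by push_cast; ring]
      at h2
    refine (lintegral_mono fun g => ?_).trans h2
    have h3 := ofReal_inv_gram_diag_le (insertRow j g H) N hN j (fun k hk => by
      obtain ⟨k, rfl⟩ := Fin.exists_succAbove_eq hk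
      rw [insertRow_row_succAbove]
      ext i
      exact congrFun (congrFun hNH i) k)
    rwa [insertRow_row_self] at h3
  exact (lintegral_gaussMatrix_succ j
    (ENNReal.measurable_ofReal.comp (measurable_inv_apply measurable_gram_apply j j))).trans_le
    ((lintegral_mono h).trans (by simp))

lemma lintegral_sum_sq_inv_gram_mul_le {r m : ℕ} (hm : r + 1 < m) :
    ∫⁻ T, ENNReal.ofReal (∑ i, ∑ j, ((T * Tᵀ)⁻¹ * T) i j ^ 2) ∂gaussMatrix r m
      ≤ ENNReal.ofReal (r / ((m : ℝ) - r - 1)) := by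
  have h : ∀ T : Matrix (Fin r) (Fin m) ℝ,
      ENNReal.ofReal (∑ i, ∑ j, ((T * Tᵀ)⁻¹ * T) i j ^ 2)
        = ∑ i, ENNReal.ofReal ((T * Tᵀ)⁻¹ i i) := by
    intro T
    refine (ENNReal.ofReal_sum_of_nonneg fun i _ => Finset.sum_nonneg fun j _ =>
      sq_nonneg (((T * Tᵀ)⁻¹ * T) i j)).trans ?_
    exact Finset.sum_congr rfl fun i _ => congrArg _ (sum_sq_inv_gram_mul T i)
  simp_rw [h]
  refine (lintegral_finsetSum _ (fun i _ =>
    ENNReal.measurable_ofReal.comp (measurable_inv_apply measurable_gram_apply i i))).trans_le ?_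
  refine (Finset.sum_le_sum fun i _ => lintegral_inv_gram_diag_le hm i).trans ?_
  simp only [Finset.sum_const, Finset.card_univ, Fintype.card_fin, nsmul_eq_mul]
  rw [← ENNReal.ofReal_natCast, ← ENNReal.ofReal_mul (by positivity), mul_one_div]

lemma insertRow_zero_submatrix_succ {r m : ℕ} (g : Fin m → ℝ) (H : Matrix (Fin r) (Fin m) ℝ) :
    (insertRow 0 g H).submatrix Fin.succ id = H := by
  ext k i
  exact congrFun (insertRow_row_succAbove 0 g H k) i

lemma insertRow_zero_mul_transpose {r n : ℕ} {V : Matrix (Fin r) (Fin n) ℝ} (hV : V * Vᵀ = 1)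
    {v : Fin n → ℝ} (hv : v ⬝ᵥ v = 1) (hVv : V *ᵥ v = 0) :
    insertRow 0 v V * (insertRow 0 v V)ᵀ = 1 := by
  have h : ∀ i j, (insertRow 0 v V * (insertRow 0 v V)ᵀ) i j
      = (insertRow 0 v V).row i ⬝ᵥ (insertRow 0 v V).row j := fun i j => rfl
  have h0 : (insertRow 0 v V).row 0 = v := insertRow_row_self 0 v V
  have hs : ∀ k : Fin r, (insertRow 0 v V).row k.succ = V.row k :=
    insertRow_row_succAbove 0 v V
  have hr : ∀ k : Fin r, V.row k ⬝ᵥ v = 0 := fun k => congrFun hVv k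
  ext i j
  rw [h]
  refine Fin.cases ?_ (fun i => ?_) i <;> refine Fin.cases ?_ (fun j => ?_) j
  · rw [h0, hv, Matrix.one_apply_eq]
  · rw [h0, hs, dotProduct_comm, hr, Matrix.one_apply_ne (Fin.succ_ne_zero j).symm]
  · rw [h0, hs, hr, Matrix.one_apply_ne (Fin.succ_ne_zero i)]
  · rw [hs, hs]
    refine (congrFun (congrFun hV i) j).trans ?_
    simp [Matrix.one_apply]

lemma ae_det_gram_mul_ne_zero {r n m : ℕ} (hm : r + 1 < m) (V : Matrix (Fin r) (Fin n) ℝ)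
    (hV : V * Vᵀ = 1) : ∀ᵐ Ω ∂gaussMatrix n m, ((V * Ω) * (V * Ω)ᵀ).det ≠ 0 := by
  have h := ae_det_gram_ne_zero hm
  rw [← map_mul_gaussMatrix V hV] at h
  exact ae_of_ae_map (measurable_matrix_mul_left V).aemeasurable h

lemma measurable_sum_sq_inv_gram_mul_mulVec {α : Type*} [MeasurableSpace α] {r m : ℕ}
    {T : α → Matrix (Fin r) (Fin m) ℝ} {y : α → Fin m → ℝ}
    (hT : ∀ i j, Measurable fun x => T x i j) (hy : ∀ j, Measurable fun x => y x j) :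
    Measurable fun x =>
      ENNReal.ofReal (∑ i, (((T x * (T x)ᵀ)⁻¹ * T x) *ᵥ y x) i ^ 2) := by
  refine ENNReal.measurable_ofReal.comp (Finset.measurable_sum _ fun i _ => ?_)
  refine Measurable.pow_const ?_ 2
  simp only [Matrix.mulVec, dotProduct]
  refine Finset.measurable_sum _ fun j _ => Measurable.mul ?_ (hy j)
  exact measurable_mul_apply
    (measurable_inv_apply (measurable_mul_apply hT fun a b => hT b a)) hT i j

lemma lintegral_sum_sq_inv_gram_mul_mulVec_le {r m : ℕ} (hm : r + 1 < m) :
    ∫⁻ G, ENNReal.ofReal (∑ i, ((((G.submatrix Fin.succ id) * (G.submatrix Fin.succ id)ᵀ)⁻¹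
        * G.submatrix Fin.succ id) *ᵥ G.row 0) i ^ 2) ∂gaussMatrix (r + 1) m
      ≤ ENNReal.ofReal (r / ((m : ℝ) - r - 1)) := by
  refine (lintegral_gaussMatrix_succ 0 (measurable_sum_sq_inv_gram_mul_mulVec
    (T := fun G : Matrix (Fin (r + 1)) (Fin m) ℝ => G.submatrix Fin.succ id)
    (y := fun G => G.row 0) (fun i j => measurable_matrix_entry i.succ j)
    (fun j => measurable_matrix_entry 0 j))).trans_le
    ?_
  refine (lintegral_mono fun H => ?_).trans (lintegral_sum_sq_inv_gram_mul_le hm)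
  refine (lintegral_congr fun g => ?_).trans_le
    (lintegral_sum_sq_mulVec_gaussVec ((H * Hᵀ)⁻¹ * H)).le
  rw [insertRow_zero_submatrix_succ, insertRow_row_self]

lemma lintegral_sum_sq_inv_gram_mul_mulVec_transpose_le {r n m : ℕ} (hm : r + 1 < m)
    (V : Matrix (Fin r) (Fin n) ℝ) (hV : V * Vᵀ = 1) (w : Fin n → ℝ) (hw : V *ᵥ w = 0) :
    ∫⁻ Ω, ENNReal.ofReal (∑ i,
        ((((V * Ω) * (V * Ω)ᵀ)⁻¹ * (V * Ω)) *ᵥ (Ωᵀ *ᵥ w)) i ^ 2) ∂gaussMatrix n m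
      ≤ ENNReal.ofReal (r / ((m : ℝ) - r - 1) * ∑ i, w i ^ 2) := by
  rw [sum_sq_eq_dotProduct w]
  have hw0 : 0 ≤ w ⬝ᵥ w := Finset.sum_nonneg fun i _ => mul_self_nonneg (w i)
  rcases hw0.eq_or_lt with h0 | h0
  · simp [dotProduct_self_eq_zero.1 h0.symm]
  have hs : √(w ⬝ᵥ w) * √(w ⬝ᵥ w) = w ⬝ᵥ w := Real.mul_self_sqrt h0.le
  have hs0 : √(w ⬝ᵥ w) ≠ 0 := (Real.sqrt_pos.2 h0).ne'
  set v := (√(w ⬝ᵥ w))⁻¹ • w with hv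
  have hvv : v ⬝ᵥ v = 1 := by
    rw [hv, smul_dotProduct, dotProduct_smul, smul_eq_mul, smul_eq_mul, ← mul_assoc, ← mul_inv,
      hs, inv_mul_cancel₀ h0.ne']
  have hVv : V *ᵥ v = 0 := by rw [hv, Matrix.mulVec_smul, hw, smul_zero]
  have hwv : w = √(w ⬝ᵥ w) • v := by rw [hv, smul_smul, mul_inv_cancel₀ hs0, one_smul]
  have hV' := insertRow_zero_mul_transpose hV hvv hVv
  have hle := lintegral_sum_sq_inv_gram_mul_mulVec_le hm
  rw [← map_mul_gaussMatrix _ hV'] at hle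
  have hle := (lintegral_map (measurable_sum_sq_inv_gram_mul_mulVec
    (T := fun G : Matrix (Fin (r + 1)) (Fin m) ℝ => G.submatrix Fin.succ id)
    (y := fun G => G.row 0) (fun i j => measurable_matrix_entry i.succ j)
    (fun j => measurable_matrix_entry 0 j))
    (measurable_matrix_mul_left (insertRow 0 v V))).symm.trans_le hle
  have hsub : ∀ Ω : Matrix (Fin n) (Fin m) ℝ,
      (insertRow 0 v V * Ω).submatrix Fin.succ id = V * Ω := by
    intro Ω
    rw [Matrix.submatrix_mul _ _ _ id _ Function.bijective_id, insertRow_zero_submatrix_succ,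
      Matrix.submatrix_id_id]
  have hrow : ∀ Ω : Matrix (Fin n) (Fin m) ℝ, (insertRow 0 v V * Ω).row 0 = Ωᵀ *ᵥ v := by
    intro Ω
    rw [Matrix.mulVec_transpose]
    exact congrArg (fun x => x ᵥ* Ω) (insertRow_row_self 0 v V)
  simp_rw [hsub] at hle
  simp only [hrow] at hle
  rw [mul_comm, ENNReal.ofReal_mul h0.le]
  refine le_trans (le_of_eq ?_) (mul_le_mul_right hle (ENNReal.ofReal (w ⬝ᵥ w)))
  rw [← lintegral_const_mul' _ _ ENNReal.ofReal_ne_top]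
  refine lintegral_congr fun Ω => ?_
  rw [← ENNReal.ofReal_mul h0.le]
  congr 1
  rw [Finset.mul_sum]
  refine Finset.sum_congr rfl fun i _ => ?_
  conv_lhs => rw [hwv, Matrix.mulVec_smul, Matrix.mulVec_smul, Pi.smul_apply, smul_eq_mul, mul_pow]
  rw [sq √(w ⬝ᵥ w), hs]

lemma frobSq_eq_sum {m n : ℕ} (M : Matrix (Fin m) (Fin n) ℝ) :
    frobSq M = ∑ i, ∑ j, M i j ^ 2 := by
  simp only [frobSq, Real.norm_eq_abs, sq_abs]

lemma frobSq_nonneg {m n : ℕ} (M : Matrix (Fin m) (Fin n) ℝ) : 0 ≤ frobSq M :=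
  Finset.sum_nonneg fun _ _ => Finset.sum_nonneg fun _ _ => sq_nonneg _

lemma frobSq_transpose {m n : ℕ} (M : Matrix (Fin m) (Fin n) ℝ) : frobSq Mᵀ = frobSq M :=
  Finset.sum_comm

lemma frobSq_eq_trace {m n : ℕ} (M : Matrix (Fin m) (Fin n) ℝ) :
    frobSq M = (Mᵀ * M).trace := by
  rw [← frobSq_transpose, frobSq_eq_sum]
  simp [Matrix.trace, Matrix.mul_apply, sq]

lemma frobSq_eq_sum_mulVec {m n p : ℕ} (S : Matrix (Fin m) (Fin n) ℝ)
    (W : Matrix (Fin n) (Fin p) ℝ) : frobSq (S * W) = ∑ j, ∑ i, (S *ᵥ W.col j) i ^ 2 := by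
  rw [← frobSq_transpose, frobSq_eq_sum]
  rfl

lemma frobSq_sub_mul {m n r : ℕ} (E : Matrix (Fin m) (Fin n) ℝ) (Q : Matrix (Fin m) (Fin r) ℝ)
    (hQ : Qᵀ * Q = 1) (hE : Qᵀ * E = 0) (Y : Matrix (Fin r) (Fin n) ℝ) :
    frobSq (E - Q * Y) = frobSq E + frobSq Y := by
  have hE' : Eᵀ * Q = 0 := by
    rw [← Matrix.transpose_transpose (Eᵀ * Q), Matrix.transpose_mul, Matrix.transpose_transpose,
      hE, Matrix.transpose_zero]
  have h : (E - Q * Y)ᵀ * (E - Q * Y) = Eᵀ * E + Yᵀ * Y := by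
    rw [Matrix.transpose_sub, Matrix.sub_mul, Matrix.mul_sub, Matrix.mul_sub, ← Matrix.mul_assoc Eᵀ,
      hE', Matrix.transpose_mul, Matrix.mul_assoc Yᵀ, hE, Matrix.mul_assoc Yᵀ,
      ← Matrix.mul_assoc Qᵀ, hQ]
    simp
  rw [frobSq_eq_trace, h, Matrix.trace_add, ← frobSq_eq_trace, ← frobSq_eq_trace]

lemma transpose_mul_sub_proj {m n r : ℕ} (A : Matrix (Fin m) (Fin n) ℝ)
    (Q : Matrix (Fin m) (Fin r) ℝ) (hQ : Qᵀ * Q = 1) : Qᵀ * (A - Q * (Qᵀ * A)) = 0 := by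
  rw [Matrix.mul_sub, ← Matrix.mul_assoc Qᵀ Q, hQ, Matrix.one_mul, sub_self]

lemma frobSq_sub_proj_le {m n r : ℕ} (A : Matrix (Fin m) (Fin n) ℝ)
    (Q : Matrix (Fin m) (Fin r) ℝ) (hQ : Qᵀ * Q = 1) (N : Matrix (Fin r) (Fin n) ℝ) :
    frobSq (A - Q * (Qᵀ * A)) ≤ frobSq (A - Q * N) := by
  have h := frobSq_sub_mul _ Q hQ (transpose_mul_sub_proj A Q hQ) (N - Qᵀ * A)
  rw [Matrix.mul_sub, sub_sub_sub_cancel_right] at h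
  rw [h]
  exact le_add_of_nonneg_right (frobSq_nonneg _)

lemma frobSq_sub_symm_le {n : ℕ} (A B : Matrix (Fin n) (Fin n) ℝ) (hA : Aᵀ = A) :
    frobSq (A - (1 / 2 : ℝ) • (B + Bᵀ)) ≤ frobSq (A - B) := by
  have h : ∀ i j, (A - (1 / 2 : ℝ) • (B + Bᵀ)) i j ^ 2
      ≤ 1 / 2 * (A - B) i j ^ 2 + 1 / 2 * (A - B)ᵀ i j ^ 2 := by
    intro i j
    have hij : A j i = A i j := congrFun (congrFun hA i) j
    simp only [Matrix.sub_apply, Matrix.smul_apply, Matrix.add_apply, Matrix.transpose_apply,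
      smul_eq_mul, hij]
    nlinarith [sq_nonneg (B i j - B j i)]
  calc frobSq (A - (1 / 2 : ℝ) • (B + Bᵀ))
      ≤ ∑ i, ∑ j, (1 / 2 * (A - B) i j ^ 2 + 1 / 2 * (A - B)ᵀ i j ^ 2) := by
        rw [frobSq_eq_sum]
        exact Finset.sum_le_sum fun i _ => Finset.sum_le_sum fun j _ => h i j
    _ = 1 / 2 * frobSq (A - B) + 1 / 2 * frobSq (A - B)ᵀ := by
        simp only [Finset.sum_add_distrib, ← Finset.mul_sum, frobSq_eq_sum]
    _ = frobSq (A - B) := by rw [frobSq_transpose]; ring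

lemma frobSq_sub_sketch {n m r p : ℕ} (V : Matrix (Fin r) (Fin n) ℝ) (hV : V * Vᵀ = 1)
    (Ω : Matrix (Fin n) (Fin m) ℝ) (hdet : ((V * Ω) * (V * Ω)ᵀ).det ≠ 0)
    (B : Matrix (Fin n) (Fin p) ℝ) :
    frobSq (B - Vᵀ * (((V * Ω) * (V * Ω)ᵀ)⁻¹ * (V * Ω) * (Ωᵀ * B)))
      = frobSq (B - Vᵀ * (V * B))
        + frobSq (((V * Ω) * (V * Ω)ᵀ)⁻¹ * (V * Ω) * (Ωᵀ * (B - Vᵀ * (V * B)))) := by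
  have hE := transpose_mul_sub_proj B Vᵀ (by rwa [Matrix.transpose_transpose])
  rw [Matrix.transpose_transpose] at hE
  have h := frobSq_sub_mul _ Vᵀ (by rwa [Matrix.transpose_transpose])
    (by rwa [Matrix.transpose_transpose])
    (((V * Ω) * (V * Ω)ᵀ)⁻¹ * (V * Ω) * (Ωᵀ * (B - Vᵀ * (V * B))))
  rw [← h]
  congr 1
  have h2 : ((V * Ω) * (V * Ω)ᵀ)⁻¹ * (V * Ω) * (Ωᵀ * (Vᵀ * (V * B))) = V * B := by
    rw [← Matrix.mul_assoc Ωᵀ, ← Matrix.transpose_mul, Matrix.mul_assoc _ (V * Ω),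
      ← Matrix.mul_assoc (V * Ω), ← Matrix.mul_assoc,
      Matrix.nonsing_inv_mul _ (isUnit_iff_ne_zero.2 hdet), Matrix.one_mul]
  rw [Matrix.mul_sub Ωᵀ, Matrix.mul_sub, h2, Matrix.mul_sub]
  abel

lemma lintegral_frobSq_inv_gram_mul_le {r n m p : ℕ} (hm : r + 1 < m)
    (V : Matrix (Fin r) (Fin n) ℝ) (hV : V * Vᵀ = 1) (W : Matrix (Fin n) (Fin p) ℝ)
    (hW : V * W = 0) :
    ∫⁻ Ω, ENNReal.ofReal (frobSq (((V * Ω) * (V * Ω)ᵀ)⁻¹ * (V * Ω) * (Ωᵀ * W))) ∂gaussMatrix n m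
      ≤ ENNReal.ofReal (r / ((m : ℝ) - r - 1) * frobSq W) := by
  have hm' : (r : ℝ) + 1 < m := by exact_mod_cast hm
  have hc : 0 ≤ r / ((m : ℝ) - r - 1) := div_nonneg (by positivity) (by linarith)
  have h : ∀ Ω : Matrix (Fin n) (Fin m) ℝ,
      ENNReal.ofReal (frobSq (((V * Ω) * (V * Ω)ᵀ)⁻¹ * (V * Ω) * (Ωᵀ * W)))
      = ∑ j, ENNReal.ofReal (∑ i,
          ((((V * Ω) * (V * Ω)ᵀ)⁻¹ * (V * Ω)) *ᵥ (Ωᵀ *ᵥ W.col j)) i ^ 2) := by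
    intro Ω
    rw [frobSq_eq_sum_mulVec]
    exact ENNReal.ofReal_sum_of_nonneg fun j _ => Finset.sum_nonneg fun i _ => sq_nonneg _
  have hmeas : ∀ j, Measurable fun Ω : Matrix (Fin n) (Fin m) ℝ => ENNReal.ofReal (∑ i,
      ((((V * Ω) * (V * Ω)ᵀ)⁻¹ * (V * Ω)) *ᵥ (Ωᵀ *ᵥ W.col j)) i ^ 2) := by
    intro j
    refine measurable_sum_sq_inv_gram_mul_mulVec (T := fun Ω => V * Ω)
      (y := fun Ω => Ωᵀ *ᵥ W.col j)
      (fun a b => (measurable_matrix_entry a b).comp (measurable_matrix_mul_left V)) fun a => ?_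
    simp only [Matrix.mulVec, dotProduct]
    exact Finset.measurable_sum _ fun b _ => (measurable_matrix_entry b a).mul_const _
  calc _ = ∑ j, ∫⁻ Ω, ENNReal.ofReal (∑ i, ((((V * Ω) * (V * Ω)ᵀ)⁻¹ * (V * Ω))
          *ᵥ (Ωᵀ *ᵥ W.col j)) i ^ 2) ∂gaussMatrix n m :=
        (lintegral_congr h).trans (lintegral_finsetSum _ fun j _ => hmeas j)
    _ ≤ ∑ j, ENNReal.ofReal (r / ((m : ℝ) - r - 1) * ∑ i, W.col j i ^ 2) :=
        Finset.sum_le_sum fun j _ => lintegral_sum_sq_inv_gram_mul_mulVec_transpose_le hm V hV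
          (W.col j) (funext fun i => congrFun (congrFun hW i) j)
    _ = _ := by
        rw [← ENNReal.ofReal_sum_of_nonneg fun j _ =>
          mul_nonneg hc (Finset.sum_nonneg fun i _ => sq_nonneg _), ← Finset.mul_sum,
          ← frobSq_transpose W, frobSq_eq_sum]
        rfl

lemma lintegral_frobSq_sub_sketch_le {r n m p : ℕ} (hm : r + 1 < m)
    (V : Matrix (Fin r) (Fin n) ℝ) (hV : V * Vᵀ = 1) (B : Matrix (Fin n) (Fin p) ℝ) :
    ∫⁻ Ω, ENNReal.ofReal (frobSq
        (B - Vᵀ * (((V * Ω) * (V * Ω)ᵀ)⁻¹ * (V * Ω) * (Ωᵀ * B)))) ∂gaussMatrix n m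
      ≤ ENNReal.ofReal ((1 + r / ((m : ℝ) - r - 1)) * frobSq (B - Vᵀ * (V * B))) := by
  have hm' : (r : ℝ) + 1 < m := by exact_mod_cast hm
  have hc : 0 ≤ r / ((m : ℝ) - r - 1) := div_nonneg (by positivity) (by linarith)
  have hE := transpose_mul_sub_proj B Vᵀ (by rwa [Matrix.transpose_transpose])
  rw [Matrix.transpose_transpose] at hE
  have h : ∀ᵐ Ω ∂gaussMatrix n m, ENNReal.ofReal (frobSq
        (B - Vᵀ * (((V * Ω) * (V * Ω)ᵀ)⁻¹ * (V * Ω) * (Ωᵀ * B))))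
      = ENNReal.ofReal (frobSq (B - Vᵀ * (V * B))) + ENNReal.ofReal (frobSq
        (((V * Ω) * (V * Ω)ᵀ)⁻¹ * (V * Ω) * (Ωᵀ * (B - Vᵀ * (V * B))))) := by
    filter_upwards [ae_det_gram_mul_ne_zero hm V hV] with Ω hΩ
    rw [frobSq_sub_sketch V hV Ω hΩ B, ENNReal.ofReal_add (frobSq_nonneg _) (frobSq_nonneg _)]
  rw [lintegral_congr_ae h, lintegral_add_left measurable_const, lintegral_const, measure_univ,
    mul_one, add_mul, one_mul,
    ENNReal.ofReal_add (frobSq_nonneg _) (mul_nonneg hc (frobSq_nonneg _))]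
  gcongr
  exact lintegral_frobSq_inv_gram_mul_le hm V hV _ hE

lemma measurePreserving_transpose_gaussMatrix (r m : ℕ) :
    MeasurePreserving (fun Ω : Matrix (Fin r) (Fin m) ℝ => Ωᵀ) (gaussMatrix r m)
      (gaussMatrix m r) :=
  ⟨measurable_matrix_transpose, map_transpose_gaussMatrix r m⟩

/-- Transposition as a measurable equivalence. -/
def transposeMeasurableEquiv (r m : ℕ) :
    Matrix (Fin r) (Fin m) ℝ ≃ᵐ Matrix (Fin m) (Fin r) ℝ where
  toFun := Matrix.transpose
  invFun := Matrix.transpose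
  measurable_toFun := measurable_matrix_transpose
  measurable_invFun := measurable_matrix_transpose

lemma lintegral_gaussMatrix_transpose {r m : ℕ} (f : Matrix (Fin r) (Fin m) ℝ → ENNReal) :
    ∫⁻ Ω, f Ωᵀ ∂gaussMatrix m r = ∫⁻ Ω, f Ω ∂gaussMatrix r m :=
  (measurePreserving_transpose_gaussMatrix m r).lintegral_comp_emb
    (transposeMeasurableEquiv m r).measurableEmbedding f

lemma lintegral_frobSq_sub_symm_sketch_le {n k ℓ : ℕ} (hℓ : k + 1 < ℓ)
    (A : Matrix (Fin n) (Fin n) ℝ) (hA : Aᵀ = A) (Q : Matrix (Fin n) (Fin k) ℝ)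
    (hQ : Qᵀ * Q = 1) :
    ∫⁻ Ψ, ENNReal.ofReal (frobSq (A - (1 / 2 : ℝ) •
        (Q * (((Ψ * Q)ᵀ * (Ψ * Q))⁻¹ * (Ψ * Q)ᵀ * (Ψ * A))
          + (Q * (((Ψ * Q)ᵀ * (Ψ * Q))⁻¹ * (Ψ * Q)ᵀ * (Ψ * A)))ᵀ))) ∂gaussMatrix ℓ n
      ≤ ENNReal.ofReal ((1 + k / ((ℓ : ℝ) - k - 1)) * frobSq (A - Q * (Qᵀ * A))) := by
  have h := lintegral_frobSq_sub_sketch_le hℓ Qᵀ (by rwa [Matrix.transpose_transpose]) A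
  rw [← lintegral_gaussMatrix_transpose] at h
  simp only [← Matrix.transpose_mul, Matrix.transpose_transpose] at h
  exact (lintegral_mono fun Ψ =>
    ENNReal.ofReal_le_ofReal (frobSq_sub_symm_le A _ hA)).trans h

lemma lintegral_frobSq_sub_range_proj_le {n k ϱ : ℕ} (A B : Matrix (Fin n) (Fin n) ℝ)
    (Q : Matrix (Fin n) (Fin k) ℝ → Matrix (Fin n) (Fin k) ℝ)
    (hQorth : ∀ Ω, (Q Ω)ᵀ * Q Ω = 1)
    (hQrange : ∀ Ω, ∃ M : Matrix (Fin k) (Fin k) ℝ, A * Ω = Q Ω * M)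
    (hϱ : ϱ + 1 < k) (hB : B.rank < ϱ + 1) :
    ∫⁻ Ω, ENNReal.ofReal (frobSq (A - Q Ω * ((Q Ω)ᵀ * A))) ∂gaussMatrix n k
      ≤ ENNReal.ofReal ((1 + ϱ / ((k : ℝ) - ϱ - 1)) * frobSq (A - B)) := by
  obtain ⟨V, hV, hBV⟩ := exists_orthonormal_rows_rank B
  have h := lintegral_frobSq_sub_sketch_le (m := k) (by omega) V hV Aᵀ
  have hϱ' : (ϱ : ℝ) + 1 < k := by exact_mod_cast hϱ
  have hB' : (B.rank : ℝ) ≤ ϱ := by exact_mod_cast Nat.lt_succ_iff.1 hB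
  have hproj : frobSq (Aᵀ - Vᵀ * (V * Aᵀ)) ≤ frobSq (A - B) := by
    have h1 := frobSq_sub_proj_le Aᵀ Vᵀ (by rwa [Matrix.transpose_transpose]) (V * Bᵀ)
    have h2 : Vᵀ * (V * Bᵀ) = Bᵀ := by
      conv_rhs => rw [← hBV]
      simp only [Matrix.transpose_mul, Matrix.transpose_transpose]
    rwa [h2, Matrix.transpose_transpose, ← Matrix.transpose_sub, frobSq_transpose] at h1
  refine (lintegral_mono fun Ω => ENNReal.ofReal_le_ofReal ?_).trans
    (h.trans (ENNReal.ofReal_le_ofReal ?_))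
  · obtain ⟨M, hM⟩ := hQrange Ω
    refine (frobSq_sub_proj_le A (Q Ω) (hQorth Ω)
      (M * (((V * Ω) * (V * Ω)ᵀ)⁻¹ * (V * Ω))ᵀ * V)).trans_eq ?_
    rw [← frobSq_transpose]
    congr 1
    rw [← Matrix.mul_assoc, ← Matrix.mul_assoc, ← hM]
    simp only [Matrix.transpose_sub, Matrix.transpose_mul, Matrix.transpose_transpose,
      Matrix.mul_assoc]
  · refine mul_le_mul ?_ hproj (frobSq_nonneg _) ?_
    · gcongr
      linarith
    · have : 0 ≤ (ϱ : ℝ) / ((k : ℝ) - ϱ - 1) := div_nonneg (by positivity) (by linarith)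
      linarith

lemma le_mul_tailEnergySq {m n j : ℕ} (hj : 0 < j) (A : Matrix (Fin m) (Fin n) ℝ) {c x : ℝ}
    (hc : 0 < c) (h : ∀ B : Matrix (Fin m) (Fin n) ℝ, B.rank < j → x ≤ c * frobSq (A - B)) :
    x ≤ c * tailEnergySq A j := by
  rw [mul_comm, ← div_le_iff₀ hc]
  refine le_csInf ⟨_, 0, by simpa using hj, rfl⟩ ?_
  rintro _ ⟨B, hB, rfl⟩
  rw [div_le_iff₀ hc, mul_comm]
  exact h B hB

lemma integral_le_of_lintegral_ofReal_le {α : Type*} [MeasurableSpace α] {μ : Measure α}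
    {f : α → ℝ} (hf : ∀ x, 0 ≤ f x) {c : ℝ} (hc : 0 ≤ c)
    (h : ∫⁻ x, ENNReal.ofReal (f x) ∂μ ≤ ENNReal.ofReal c) : ∫ x, f x ∂μ ≤ c := by
  by_cases hi : Integrable f μ
  · rwa [← ofReal_integral_eq_lintegral_ofReal hi (.of_forall hf),
      ENNReal.ofReal_le_ofReal_iff hc] at h
  · rwa [integral_undef hi]

/-- **Corollary 5.3 (low-rank symmetric approximation error), real case.**
For symmetric `A ∈ ℝ^{n×n}`, independent standard normal `Ω ∈ ℝ^{n×k}`, `Ψ ∈ ℝ^{ℓ×n}`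
with `k ≤ n`, `ℓ ≤ n`, `ℓ > k + 1`, a measurable orthonormal-range factor `Q(Ω)` whose
column space contains that of `AΩ`, `X = (ΨQ)† Ψ A`, and the symmetrized approximation
`Â_sym = (QX + (QX)ᵀ)/2`, for every `ϱ < k - 1`:
`E ‖A - Â_sym‖_F² ≤ (1 + k/(ℓ-k-1)) (1 + ϱ/(k-ϱ-1)) τ_{ϱ+1}(A)²`. -/
theorem sketched_symmetric_approx_error {n k ℓ : ℕ}
    (hkn : k ≤ n) (hℓn : ℓ ≤ n) (hℓ : k + 1 < ℓ)
    (A : Matrix (Fin n) (Fin n) ℝ) (hA : Aᵀ = A)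
    (Q : Matrix (Fin n) (Fin k) ℝ → Matrix (Fin n) (Fin k) ℝ)
    (hQmeas : Measurable Q)
    (hQorth : ∀ Ω, (Q Ω)ᵀ * Q Ω = 1)
    (hQrange : ∀ Ω, ∃ M : Matrix (Fin k) (Fin k) ℝ, A * Ω = Q Ω * M)
    (ϱ : ℕ) (hϱ : ϱ + 1 < k) :
    ∫ p, frobSq (A - (1 / 2 : ℝ) •
        (Q p.1 * (((p.2 * Q p.1)ᵀ * (p.2 * Q p.1))⁻¹ * (p.2 * Q p.1)ᵀ * (p.2 * A))
          + (Q p.1 * (((p.2 * Q p.1)ᵀ * (p.2 * Q p.1))⁻¹ * (p.2 * Q p.1)ᵀ * (p.2 * A)))ᵀ))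
        ∂((gaussMatrix n k).prod (gaussMatrix ℓ n))
      ≤ (1 + (k : ℝ) / ((ℓ : ℝ) - k - 1)) * (1 + (ϱ : ℝ) / ((k : ℝ) - ϱ - 1))
        * tailEnergySq A (ϱ + 1) := by
  have hℓ' : (k : ℝ) + 1 < ℓ := by exact_mod_cast hℓ
  have hϱ' : (ϱ : ℝ) + 1 < k := by exact_mod_cast hϱ
  have hc₁ : 0 ≤ (k : ℝ) / ((ℓ : ℝ) - k - 1) := div_nonneg (by positivity) (by linarith)
  have hc₂ : 0 ≤ (ϱ : ℝ) / ((k : ℝ) - ϱ - 1) := div_nonneg (by positivity) (by linarith)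
  refine le_mul_tailEnergySq (Nat.succ_pos ϱ) A (by positivity) fun B hB => ?_
  refine integral_le_of_lintegral_ofReal_le (fun _ => frobSq_nonneg _)
    (mul_nonneg (by positivity) (frobSq_nonneg _)) ((lintegral_prod_le _).trans ?_)
  refine (lintegral_mono fun Ω =>
    lintegral_frobSq_sub_symm_sketch_le hℓ A hA (Q Ω) (hQorth Ω)).trans ?_
  simp_rw [ENNReal.ofReal_mul (add_nonneg zero_le_one hc₁)]
  rw [lintegral_const_mul' _ _ ENNReal.ofReal_ne_top, mul_assoc (1 + _),
    ENNReal.ofReal_mul (by positivity)]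
  gcongr
  exact lintegral_frobSq_sub_range_proj_le A B Q hQorth hQrange hϱ hB
end

section
/- Let F be ℝ or ℂ. Let A, Â_in ∈ F^{m×n} and let r be a natural number. Suppose B ∈ F^{m×n} has rank at most r and is a best rank-r approximation of Â_in in Frobenius norm, i.e., ‖Â_in − B‖_F ≤ ‖Â_in − C‖_F for every C ∈ F^{m×n} with rank(C) ≤ r. Then ‖A − B‖_F ≤ τ_{r+1}(A) + 2 ‖A − Â_in‖_F. (Proposition 6.1, error for fixed-rank approximation.) -/
open Matrix

/-- Frobenius norm of a matrix. -/
noncomputable def frobNorm {𝕜 : Type*} [RCLike 𝕜] {m n : ℕ}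
    (M : Matrix (Fin m) (Fin n) 𝕜) : ℝ :=
  Real.sqrt (∑ i, ∑ j, ‖M i j‖ ^ 2)

/-- `j`-th tail energy: `τ_j(A) = sqrt (inf {‖A - B‖_F² : rank B < j})`. -/
noncomputable def tailEnergy {𝕜 : Type*} [RCLike 𝕜] {m n : ℕ}
    (A : Matrix (Fin m) (Fin n) 𝕜) (j : ℕ) : ℝ :=
  Real.sqrt (sInf {x : ℝ | ∃ B : Matrix (Fin m) (Fin n) 𝕜,
    B.rank < j ∧ x = frobNorm (A - B) ^ 2})

section FrobeniusNorm

open scoped Matrix.Norms.Frobenius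

theorem frobNorm_eq_norm {𝕜 : Type*} [RCLike 𝕜] {m n : ℕ}
    (M : Matrix (Fin m) (Fin n) 𝕜) : frobNorm M = ‖M‖ := by
  simp [frobNorm, Matrix.frobenius_norm_def, Real.sqrt_eq_rpow]

theorem frobNorm_sub_le {𝕜 : Type*} [RCLike 𝕜] {m n : ℕ}
    (A B C : Matrix (Fin m) (Fin n) 𝕜) :
    frobNorm (A - C) ≤ frobNorm (A - B) + frobNorm (B - C) := by
  simpa only [frobNorm_eq_norm] using norm_sub_le_norm_sub_add_norm_sub A B C

theorem frobNorm_sub_comm {𝕜 : Type*} [RCLike 𝕜] {m n : ℕ}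
    (A B : Matrix (Fin m) (Fin n) 𝕜) : frobNorm (A - B) = frobNorm (B - A) := by
  simpa only [frobNorm_eq_norm] using norm_sub_rev A B

end FrobeniusNorm

theorem le_tailEnergy {𝕜 : Type*} [RCLike 𝕜] {m n : ℕ}
    {A : Matrix (Fin m) (Fin n) 𝕜} {j : ℕ} (hj : 0 < j) {t : ℝ}
    (h : ∀ C : Matrix (Fin m) (Fin n) 𝕜, C.rank < j → t ≤ frobNorm (A - C)) :
    t ≤ tailEnergy A j := by
  rcases le_total t 0 with ht | ht
  · exact ht.trans (Real.sqrt_nonneg _)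
  · refine Real.le_sqrt_of_sq_le (le_csInf ⟨_, 0, by simpa using hj, rfl⟩ ?_)
    rintro _ ⟨C, hC, rfl⟩
    exact pow_le_pow_left₀ ht (h C hC) 2

/-- **Proposition 6.1 (error for fixed-rank approximation).**  If `B` is a best rank-`r`
Frobenius-norm approximation of `Â_in`, then
`‖A - B‖_F ≤ τ_{r+1}(A) + 2 ‖A - Â_in‖_F`. -/
theorem fixed_rank_approx_error {𝕜 : Type*} [RCLike 𝕜] {m n : ℕ}
    (A Ain B : Matrix (Fin m) (Fin n) 𝕜) (r : ℕ)
    (hrank : B.rank ≤ r)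
    (hbest : ∀ C : Matrix (Fin m) (Fin n) 𝕜, C.rank ≤ r →
      frobNorm (Ain - B) ≤ frobNorm (Ain - C)) :
    frobNorm (A - B) ≤ tailEnergy A (r + 1) + 2 * frobNorm (A - Ain) := by
  rw [← sub_le_iff_le_add]
  refine le_tailEnergy r.succ_pos fun C hC => ?_
  have hAB := frobNorm_sub_le A Ain B
  have hAC := frobNorm_sub_le Ain A C
  have hBC := hbest C (Nat.lt_succ_iff.mp hC)
  rw [frobNorm_sub_comm Ain A] at hAC
  linarith
end

section
/- Let F be ℝ or ℂ. Let Q ∈ F^{m×k} have orthonormal columns (QᴴQ = I_k), let X ∈ F^{k×n}, and let r ≤ k. If X_r ∈ F^{k×n} has rank at most r and minimizes ‖X − ·‖_F over all matrices of rank at most r, then Q X_r has rank at most r and minimizes ‖QX − ·‖_F over all matrices in F^{m×n} of rank at most r; in particular ‖QX − Q X_r‖_F = inf{‖QX − B‖_F : B ∈ F^{m×n}, rank(B) ≤ r}. (Equation (6.3): the best rank-r approximation of QX can be computed as Q times the best rank-r approximation of X.) -/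
open Matrix

theorem frobNorm_nonneg {𝕜 : Type*} [RCLike 𝕜] {m n : ℕ}
    (M : Matrix (Fin m) (Fin n) 𝕜) : 0 ≤ frobNorm M :=
  Real.sqrt_nonneg _

theorem frobNorm_sq_eq_trace {𝕜 : Type*} [RCLike 𝕜] {m n : ℕ}
    (M : Matrix (Fin m) (Fin n) 𝕜) : ((frobNorm M ^ 2 : ℝ) : 𝕜) = (Mᴴ * M).trace := by
  have h : 0 ≤ ∑ i, ∑ j, ‖M i j‖ ^ 2 := by positivity
  rw [frobNorm, Real.sq_sqrt h, Finset.sum_comm]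
  simp [Matrix.trace, Matrix.mul_apply, RCLike.conj_mul]

/-- Left multiplication by a matrix with orthonormal columns preserves the Frobenius norm. -/
theorem frobNorm_mul_of_orthonormal_columns {𝕜 : Type*} [RCLike 𝕜] {m n k : ℕ}
    {Q : Matrix (Fin m) (Fin k) 𝕜} (hQ : Qᴴ * Q = 1) (Y : Matrix (Fin k) (Fin n) 𝕜) :
    frobNorm (Q * Y) = frobNorm Y := by
  have h : ((frobNorm (Q * Y) ^ 2 : ℝ) : 𝕜) = ((frobNorm Y ^ 2 : ℝ) : 𝕜) := by
    rw [frobNorm_sq_eq_trace, frobNorm_sq_eq_trace, Matrix.conjTranspose_mul, Matrix.mul_assoc,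
      ← Matrix.mul_assoc Qᴴ, hQ, Matrix.one_mul]
  exact (sq_eq_sq₀ (frobNorm_nonneg _) (frobNorm_nonneg _)).mp (RCLike.ofReal_injective h)

/-- Left multiplication by the adjoint of a matrix with orthonormal columns is a contraction. -/
theorem frobNorm_conjTranspose_mul_le {𝕜 : Type*} [RCLike 𝕜] {m n k : ℕ}
    {Q : Matrix (Fin m) (Fin k) 𝕜} (hQ : Qᴴ * Q = 1) (M : Matrix (Fin m) (Fin n) 𝕜) :
    frobNorm (Qᴴ * M) ≤ frobNorm M := by
  have hN : Qᴴ * (M - Q * (Qᴴ * M)) = 0 := by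
    rw [Matrix.mul_sub, ← Matrix.mul_assoc Qᴴ Q, hQ, Matrix.one_mul, sub_self]
  have h : ((frobNorm M ^ 2 - frobNorm (Qᴴ * M) ^ 2 : ℝ) : 𝕜)
      = ((frobNorm (M - Q * (Qᴴ * M)) ^ 2 : ℝ) : 𝕜) := by
    rw [RCLike.ofReal_sub, frobNorm_sq_eq_trace, frobNorm_sq_eq_trace, frobNorm_sq_eq_trace,
      Matrix.conjTranspose_sub, Matrix.sub_mul, Matrix.conjTranspose_mul Q, Matrix.mul_assoc _ Qᴴ,
      hN, Matrix.mul_zero, sub_zero, Matrix.mul_sub, Matrix.trace_sub, Matrix.conjTranspose_mul,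
      Matrix.conjTranspose_conjTranspose, Matrix.mul_assoc Mᴴ Q]
  have h' := RCLike.ofReal_injective h
  refine (sq_le_sq₀ (frobNorm_nonneg _) (frobNorm_nonneg _)).mp ?_
  linarith [sq_nonneg (frobNorm (M - Q * (Qᴴ * M)))]

/-- **Equation (6.3).**  If `Q` has orthonormal columns and `X_r` is a best rank-`r`
Frobenius-norm approximation of `X`, then `Q X_r` is a best rank-`r` approximation of
`Q X`; in particular `‖QX - Q X_r‖_F = inf {‖QX - B‖_F : rank B ≤ r}`. -/
theorem best_fixed_rank_through_factor {𝕜 : Type*} [RCLike 𝕜] {m n k : ℕ}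
    (r : ℕ) (hr : r ≤ k)
    (Q : Matrix (Fin m) (Fin k) 𝕜) (hQ : Qᴴ * Q = 1)
    (X Xr : Matrix (Fin k) (Fin n) 𝕜) (hXr : Xr.rank ≤ r)
    (hmin : ∀ C : Matrix (Fin k) (Fin n) 𝕜, C.rank ≤ r →
      frobNorm (X - Xr) ≤ frobNorm (X - C)) :
    (Q * Xr).rank ≤ r ∧
    (∀ B : Matrix (Fin m) (Fin n) 𝕜, B.rank ≤ r →
      frobNorm (Q * X - Q * Xr) ≤ frobNorm (Q * X - B)) ∧
    frobNorm (Q * X - Q * Xr)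
      = sInf {x : ℝ | ∃ B : Matrix (Fin m) (Fin n) 𝕜,
          B.rank ≤ r ∧ x = frobNorm (Q * X - B)} := by
  have hrank : (Q * Xr).rank ≤ r := (Matrix.rank_mul_le_right Q Xr).trans hXr
  have hbest : ∀ B : Matrix (Fin m) (Fin n) 𝕜, B.rank ≤ r →
      frobNorm (Q * X - Q * Xr) ≤ frobNorm (Q * X - B) := by
    intro B hB
    calc frobNorm (Q * X - Q * Xr) = frobNorm (X - Xr) := by
          rw [← Matrix.mul_sub, frobNorm_mul_of_orthonormal_columns hQ]
      _ ≤ frobNorm (X - Qᴴ * B) := hmin _ ((Matrix.rank_mul_le_right _ _).trans hB)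
      _ = frobNorm (Qᴴ * (Q * X - B)) := by
          rw [Matrix.mul_sub, ← Matrix.mul_assoc, hQ, Matrix.one_mul]
      _ ≤ frobNorm (Q * X - B) := frobNorm_conjTranspose_mul_le hQ _
  refine ⟨hrank, hbest, Eq.symm (IsLeast.csInf_eq ?_)⟩
  refine ⟨⟨Q * Xr, hrank, rfl⟩, ?_⟩
  rintro x ⟨B, hB, rfl⟩
  exact hbest B hB
end
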